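/- Let f₁, …, f₆ be Schwartz functions on ℝ. Then 𝓔₆(f₁,…,f₆) = (1/(2π²)) ∫_ℝ (λ² − λ + 1)⁻¹ E_{A(λ)}(f₁,…,f₆) dλ, where A(λ) is the orthogonal matrix (λ² − λ + 1)⁻¹ times the matrix with rows (λ, 1−λ, λ²−λ), (λ²−λ, λ, 1−λ), (1−λ, λ²−λ, λ). -/

import Mathlib

open MeasureTheory Matrix SchwartzMap
open scoped ENNReal ComplexConjugate Real

/-- The sextilinear functional `𝓔₆`, with integration variables `(β, γ, ξ, λ)`. -/
noncomputable def E6 (f₁ f₂ f₃ f₄ f₅ f₆ : ℝ → ℂ) : ℂ :=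
  ((1 / (2 * π ^ 2) : ℝ) : ℂ) *
    ∫ p : ℝ × ℝ × ℝ × ℝ,
      f₁ (p.1 + p.2.2.1) * f₂ (p.2.2.2 * p.1 + p.2.1) *
        f₃ (p.2.2.2 * p.2.1 + p.2.2.1 - p.2.2.2 * p.2.2.1) *
        conj (f₄ (p.2.2.2 * p.1 + p.2.2.1) *
          f₅ (p.1 + p.2.2.2 * p.2.1 + p.2.2.1 - p.2.2.2 * p.2.2.1) * f₆ (p.2.1))

/-- The multilinear functional `E_A` associated to a matrix `A`. -/
noncomputable def EA (A : Matrix (Fin 3) (Fin 3) ℝ) (f₁ f₂ f₃ f₄ f₅ f₆ : ℝ → ℂ) : ℂ :=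
  ∫ x : Fin 3 → ℝ,
    f₁ (A.mulVec x 0) * f₂ (A.mulVec x 1) * f₃ (A.mulVec x 2) *
      conj (f₄ (x 0) * f₅ (x 1) * f₆ (x 2))

/-- The rotation matrix `A(λ)`. -/
noncomputable def Amat (l : ℝ) : Matrix (Fin 3) (Fin 3) ℝ :=
  (l ^ 2 - l + 1)⁻¹ •
    !![l, 1 - l, l ^ 2 - l; l ^ 2 - l, l, 1 - l; 1 - l, l ^ 2 - l, l]

/-- The change of variables `(β, γ, ξ) ↦ (λβ + ξ, β + λγ + ξ - λξ, γ)`. -/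
noncomputable def paramMat (l : ℝ) : Matrix (Fin 3) (Fin 3) ℝ :=
  !![l, 0, 1; 1, l, 1 - l; 0, 1, 0]

theorem sq_sub_add_one_pos (l : ℝ) : 0 < l ^ 2 - l + 1 := by
  nlinarith [sq_nonneg (l - 1 / 2)]

theorem det_paramMat (l : ℝ) : (paramMat l).det = l ^ 2 - l + 1 := by
  simp [paramMat, Matrix.det_fin_three]
  ring

theorem Amat_mulVec_paramMat_mulVec (l : ℝ) (y : Fin 3 → ℝ) :
    (Amat l).mulVec ((paramMat l).mulVec y) =
      ![y 0 + y 2, l * y 0 + y 1, l * y 1 + y 2 - l * y 2] := by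
  have h := inv_mul_cancel₀ (sq_sub_add_one_pos l).ne'
  unfold Amat paramMat
  generalize (l ^ 2 - l + 1)⁻¹ = k at h ⊢
  ext i
  fin_cases i <;> simp [Matrix.mulVec, dotProduct, Fin.sum_univ_three]
  · linear_combination (y 0 + y 2) * h
  · linear_combination (l * y 0 + y 1) * h
  · linear_combination (l * y 1 + y 2 - l * y 2) * h

theorem paramMat_mulVec (l : ℝ) (y : Fin 3 → ℝ) :
    (paramMat l).mulVec y = ![l * y 0 + y 2, y 0 + l * y 1 + y 2 - l * y 2, y 1] := by
  ext i
  fin_cases i <;>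
    simp [paramMat, Matrix.mulVec, dotProduct, Fin.sum_univ_three]
  ring

theorem integrable_inv_sq_sub_add_one : Integrable fun l : ℝ => (l ^ 2 - l + 1)⁻¹ := by
  refine (integrable_inv_one_add_sq.const_mul 4).mono' ?_ (ae_of_all _ fun l => ?_)
  · exact (Continuous.inv₀ (by fun_prop) fun l => (sq_sub_add_one_pos l).ne').aestronglyMeasurable
  · have h := sq_sub_add_one_pos l
    rw [Real.norm_of_nonneg (by positivity), inv_le_comm₀ h (by positivity), mul_inv, inv_inv]
    nlinarith [sq_nonneg (l - 1 / 2), sq_nonneg (l - 1)]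

/-- The integrand of `EA`. -/
noncomputable def EAIntegrand (A : Matrix (Fin 3) (Fin 3) ℝ) (f₁ f₂ f₃ f₄ f₅ f₆ : ℝ → ℂ)
    (x : Fin 3 → ℝ) : ℂ :=
  f₁ (A.mulVec x 0) * f₂ (A.mulVec x 1) * f₃ (A.mulVec x 2) *
    conj (f₄ (x 0) * f₅ (x 1) * f₆ (x 2))

theorem EAIntegrand_Amat_paramMat (f₁ f₂ f₃ f₄ f₅ f₆ : ℝ → ℂ) (l : ℝ) (y : Fin 3 → ℝ) :
    EAIntegrand (Amat l) f₁ f₂ f₃ f₄ f₅ f₆ ((paramMat l).mulVec y) =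
      f₁ (y 0 + y 2) * f₂ (l * y 0 + y 1) * f₃ (l * y 1 + y 2 - l * y 2) *
        conj (f₄ (l * y 0 + y 2) * f₅ (y 0 + l * y 1 + y 2 - l * y 2) * f₆ (y 1)) := by
  rw [EAIntegrand, Amat_mulVec_paramMat_mulVec, paramMat_mulVec]
  rfl

theorem continuous_EAIntegrand (A : Matrix (Fin 3) (Fin 3) ℝ)
    (f₁ f₂ f₃ f₄ f₅ f₆ : SchwartzMap ℝ ℂ) :
    Continuous (EAIntegrand A f₁ f₂ f₃ f₄ f₅ f₆) := by
  unfold EAIntegrand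
  simp only [Matrix.mulVec, dotProduct]
  fun_prop

theorem integrable_prod_three (f₄ f₅ f₆ : SchwartzMap ℝ ℂ) :
    Integrable fun x : Fin 3 → ℝ => f₄ (x 0) * f₅ (x 1) * f₆ (x 2) := by
  have h := Integrable.fintype_prod (μ := fun _ : Fin 3 => (volume : Measure ℝ))
    (f := fun i : Fin 3 => ((![f₄, f₅, f₆] : Fin 3 → SchwartzMap ℝ ℂ) i : ℝ → ℂ))
    (fun i => SchwartzMap.integrable _)
  simp only [Fin.prod_univ_three] at h
  exact h

theorem exists_norm_EAIntegrand_le (f₁ f₂ f₃ f₄ f₅ f₆ : SchwartzMap ℝ ℂ) :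
    ∃ C : ℝ, ∀ A x, ‖EAIntegrand A f₁ f₂ f₃ f₄ f₅ f₆ x‖ ≤
      C * ‖f₄ (x 0) * f₅ (x 1) * f₆ (x 2)‖ := by
  have hb (f : SchwartzMap ℝ ℂ) : ∃ C, ∀ x, ‖f x‖ ≤ C :=
    ⟨_, fun x => SchwartzMap.norm_le_seminorm ℝ f x⟩
  obtain ⟨C₁, h₁⟩ := hb f₁
  obtain ⟨C₂, h₂⟩ := hb f₂
  obtain ⟨C₃, h₃⟩ := hb f₃
  refine ⟨C₁ * C₂ * C₃, fun A x => ?_⟩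
  have p₁ := (norm_nonneg _).trans (h₁ 0)
  have p₂ := (norm_nonneg _).trans (h₂ 0)
  rw [EAIntegrand, norm_mul, RCLike.norm_conj, norm_mul (f₁ _ * f₂ _), norm_mul (f₁ _)]
  gcongr
  exacts [h₁ _, h₂ _, h₃ _]

theorem integrable_EAIntegrand (A : Matrix (Fin 3) (Fin 3) ℝ)
    (f₁ f₂ f₃ f₄ f₅ f₆ : SchwartzMap ℝ ℂ) :
    Integrable (EAIntegrand A f₁ f₂ f₃ f₄ f₅ f₆) := by
  obtain ⟨C, hC⟩ := exists_norm_EAIntegrand_le f₁ f₂ f₃ f₄ f₅ f₆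
  exact ((integrable_prod_three f₄ f₅ f₆).norm.const_mul C).mono'
    (continuous_EAIntegrand A f₁ f₂ f₃ f₄ f₅ f₆).aestronglyMeasurable (ae_of_all _ (hC A))

theorem map_paramMat_volume (l : ℝ) :
    Measure.map (fun y => (paramMat l).mulVec y) volume =
      ENNReal.ofReal (l ^ 2 - l + 1)⁻¹ • (volume : Measure (Fin 3 → ℝ)) := by
  have h := sq_sub_add_one_pos l
  have := Real.map_matrix_volume_pi_eq_smul_volume_pi (M := paramMat l)
    (by rw [det_paramMat]; exact h.ne')
  rw [det_paramMat, abs_of_pos (by positivity)] at this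
  exact this

theorem continuous_paramMat_mulVec (l : ℝ) : Continuous fun y => (paramMat l).mulVec y := by
  fun_prop

theorem integral_comp_paramMat {E : Type*} [NormedAddCommGroup E] [NormedSpace ℝ E]
    {g : (Fin 3 → ℝ) → E} (hg : Continuous g) (l : ℝ) :
    ∫ y, g ((paramMat l).mulVec y) = (l ^ 2 - l + 1)⁻¹ • ∫ x, g x := by
  have h := sq_sub_add_one_pos l
  rw [← integral_map (φ := fun y => (paramMat l).mulVec y)
    (continuous_paramMat_mulVec l).aemeasurable hg.aestronglyMeasurable,
    map_paramMat_volume, integral_smul_measure, ENNReal.toReal_ofReal (by positivity)]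

theorem integrable_comp_paramMat {E : Type*} [NormedAddCommGroup E]
    {g : (Fin 3 → ℝ) → E} (hg : Integrable g) (l : ℝ) :
    Integrable fun y => g ((paramMat l).mulVec y) := by
  have : Integrable g (Measure.map (fun y => (paramMat l).mulVec y) volume) := by
    rw [map_paramMat_volume]
    exact hg.smul_measure ENNReal.ofReal_ne_top
  exact this.comp_aemeasurable (continuous_paramMat_mulVec l).aemeasurable

theorem integrable_EAIntegrand_paramMat (f₁ f₂ f₃ f₄ f₅ f₆ : SchwartzMap ℝ ℂ) :
    Integrable fun q : ℝ × (Fin 3 → ℝ) =>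
      EAIntegrand (Amat q.1) f₁ f₂ f₃ f₄ f₅ f₆ ((paramMat q.1).mulVec q.2) := by
  have hm : Continuous fun q : ℝ × (Fin 3 → ℝ) =>
      EAIntegrand (Amat q.1) f₁ f₂ f₃ f₄ f₅ f₆ ((paramMat q.1).mulVec q.2) := by
    simp only [EAIntegrand_Amat_paramMat]
    fun_prop
  obtain ⟨C, hC⟩ := exists_norm_EAIntegrand_le f₁ f₂ f₃ f₄ f₅ f₆
  rw [Measure.volume_eq_prod, integrable_prod_iff hm.aestronglyMeasurable]
  refine ⟨ae_of_all _ fun l =>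
    integrable_comp_paramMat (integrable_EAIntegrand (Amat l) f₁ f₂ f₃ f₄ f₅ f₆) l, ?_⟩
  refine (integrable_inv_sq_sub_add_one.mul_const
    (∫ x : Fin 3 → ℝ, C * ‖f₄ (x 0) * f₅ (x 1) * f₆ (x 2)‖)).mono'
    (hm.norm.aestronglyMeasurable.integral_prod_right' (μ := volume) (ν := volume))
    (ae_of_all _ fun l => ?_)
  have h := sq_sub_add_one_pos l
  rw [Real.norm_of_nonneg (integral_nonneg fun _ => norm_nonneg _),
    integral_comp_paramMat (continuous_EAIntegrand (Amat l) f₁ f₂ f₃ f₄ f₅ f₆).norm,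
    smul_eq_mul]
  refine mul_le_mul_of_nonneg_left ?_ (by positivity)
  exact integral_mono (integrable_EAIntegrand (Amat l) f₁ f₂ f₃ f₄ f₅ f₆).norm
    ((integrable_prod_three f₄ f₅ f₆).norm.const_mul C) (hC (Amat l))

/-- The coordinates of `ℝ⁴` as iterated pairs. -/
def finFourToProd : (Fin 4 → ℝ) ≃ᵐ ℝ × ℝ × ℝ × ℝ :=
  (MeasurableEquiv.piFinSuccAbove (fun _ : Fin 4 => ℝ) 0).trans
    ((MeasurableEquiv.refl ℝ).prodCongr
      ((MeasurableEquiv.piFinSuccAbove (fun _ : Fin 3 => ℝ) 0).trans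
        ((MeasurableEquiv.refl ℝ).prodCongr MeasurableEquiv.finTwoArrow)))

theorem measurePreserving_finFourToProd : MeasurePreserving finFourToProd := by
  have h₂ := (MeasurePreserving.id (volume : Measure ℝ)).prod (volume_preserving_finTwoArrow ℝ)
  have h₃ := h₂.comp (volume_preserving_piFinSuccAbove (fun _ : Fin 3 => ℝ) 0)
  have h₄ := (MeasurePreserving.id (volume : Measure ℝ)).prod h₃
  exact h₄.comp (volume_preserving_piFinSuccAbove (fun _ : Fin 4 => ℝ) 0)

theorem integral_prod_four_eq (g : ℝ × ℝ × ℝ × ℝ → ℂ) :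
    ∫ p, g p = ∫ q : ℝ × (Fin 3 → ℝ), g (q.2 0, q.2 1, q.2 2, q.1) := by
  rw [← measurePreserving_finFourToProd.integral_comp' g,
    ← (volume_preserving_piFinSuccAbove (fun _ : Fin 4 => ℝ) 3).integral_comp']
  rfl

theorem stmt4 (f₁ f₂ f₃ f₄ f₅ f₆ : SchwartzMap ℝ ℂ) :
    E6 f₁ f₂ f₃ f₄ f₅ f₆
      = ((1 / (2 * π ^ 2) : ℝ) : ℂ) *
          ∫ l : ℝ, (((l ^ 2 - l + 1)⁻¹ : ℝ) : ℂ) * EA (Amat l) f₁ f₂ f₃ f₄ f₅ f₆ := by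
  rw [E6, integral_prod_four_eq]
  congr 1
  have h := integrable_EAIntegrand_paramMat f₁ f₂ f₃ f₄ f₅ f₆
  calc
    _ = ∫ q : ℝ × (Fin 3 → ℝ),
        EAIntegrand (Amat q.1) f₁ f₂ f₃ f₄ f₅ f₆ ((paramMat q.1).mulVec q.2) := by
      simp only [EAIntegrand_Amat_paramMat]
    _ = ∫ l : ℝ, ∫ y : Fin 3 → ℝ,
        EAIntegrand (Amat l) f₁ f₂ f₃ f₄ f₅ f₆ ((paramMat l).mulVec y) := by
      rw [Measure.volume_eq_prod] at h ⊢
      exact integral_prod _ h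
    _ = _ := by
      congr 1 with l
      rw [integral_comp_paramMat (continuous_EAIntegrand (Amat l) f₁ f₂ f₃ f₄ f₅ f₆),
        Complex.real_smul]
      rfl
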